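/- Let L be a complete lattice that is an X-top lattice for a subset X of L not containing ⊤, with X carrying the X-top topology. Then X is a T₀ space, and X is a T₁ space if and only if every element of X is a maximal element of X (equivalently, every element of X is simultaneously minimal and maximal in X, i.e. X has Krull dimension 0). -/

import Mathlib

/-- The variety of `a` in `X`: the set of elements of `X` lying above `a`. -/
def zarV {L : Type*} [CompleteLattice L] (X : Set L) (a : L) : Set X :=
  {x : X | a ≤ (x : L)}

/-- `L` is an `X`-top lattice: varieties are closed under (binary, hence finite) unions. -/
def IsXTop {L : Type*} [CompleteLattice L] (X : Set L) : Prop :=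
  ∀ a b : L, ∃ c : L, zarV X a ∪ zarV X b = zarV X c

/-- The `X`-top (Zariski-like) topology on `X`, generated by the sets `D(a) = (zarV X a)ᶜ`. -/
def xTopTopology {L : Type*} [CompleteLattice L] (X : Set L) : TopologicalSpace X :=
  TopologicalSpace.generateFrom {U : Set X | ∃ a : L, U = (zarV X a)ᶜ}

theorem xtop_open_lower {L : Type*} [CompleteLattice L] (X : Set L) (U : Set X)
    (hU : TopologicalSpace.GenerateOpen {U : Set X | ∃ a : L, U = (zarV X a)ᶜ} U) :
    ∀ x y : X, x ≤ y → y ∈ U → x ∈ U := by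
  induction hU with
  | basic s hs =>
    obtain ⟨a, rfl⟩ := hs
    intro x y hxy hy hx
    exact hy (le_trans (show a ≤ (x : L) from hx) hxy)
  | univ => intros; trivial
  | inter s t _ _ h1 h2 => exact fun x y h hy => ⟨h1 x y h hy.1, h2 x y h hy.2⟩
  | sUnion S _ ih =>
    rintro x y h ⟨s, hs, hy⟩
    exact ⟨s, hs, ih s hs x y h hy⟩

theorem xtop_D_open {L : Type*} [CompleteLattice L] (X : Set L) (a : L) :
    @IsOpen X (xTopTopology X) (zarV X a)ᶜ :=
  TopologicalSpace.GenerateOpen.basic _ ⟨a, rfl⟩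

theorem xtop_t0_and_t1_iff {L : Type*} [CompleteLattice L] (X : Set L)
    (hX : ⊤ ∉ X) (hXtop : IsXTop X) :
    @T0Space X (xTopTopology X) ∧
    (@T1Space X (xTopTopology X) ↔ ∀ x ∈ X, ∀ y ∈ X, x ≤ y → x = y) ∧
    (@T1Space X (xTopTopology X) ↔
      ∀ x ∈ X, (∀ y ∈ X, y ≤ x → y = x) ∧ (∀ y ∈ X, x ≤ y → x = y)) := by
  letI := xTopTopology X
  have key : T1Space X ↔ ∀ x ∈ X, ∀ y ∈ X, x ≤ y → x = y := by
    constructor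
    · intro h x hx y hy hxy
      by_contra hne
      have ho : IsOpen ({(⟨x, hx⟩ : X)}ᶜ : Set X) := isOpen_compl_singleton
      have := xtop_open_lower X _ ho ⟨x, hx⟩ ⟨y, hy⟩ hxy
        (fun h => hne (congrArg Subtype.val h).symm)
      exact this rfl
    · intro h
      refine ⟨fun x => ⟨?_⟩⟩
      have : ({x} : Set X) = zarV X (x : L) := by
        ext y
        constructor
        · rintro rfl
          exact le_refl (y : L)
        · intro hy
          exact Subtype.ext (h x x.2 y y.2 hy).symm
      rw [this]
      exact xtop_D_open X x
  refine ⟨?_, key, key.trans ?_⟩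
  · refine ⟨fun x y hxy => ?_⟩
    have h := fun a : L => hxy.mem_open_iff (xtop_D_open X a)
    apply Subtype.ext
    apply le_antisymm
    · by_contra hn
      exact (h x).2 hn (le_refl (x : L))
    · by_contra hn
      exact (h y).1 hn (le_refl (y : L))
  · exact ⟨fun h x hx => ⟨fun y hy => h y hy x hx, fun y hy => h x hx y hy⟩,
      fun h x hx => (h x hx).2⟩
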